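/- arXiv:2002.10521 — 2 statements merged into one kernel-verified Lean document; each statement's English description precedes it below -/
import Mathlib

section
/- Let $d_1, \ldots, d_n \in \mathbb{R}$, $\alpha \in \mathbb{R}^n$, $s \in \mathbb{R}$, $D = \mathrm{diag}(d_1, \ldots, d_n)$, $B = \begin{bmatrix} D & \alpha \\ \alpha^T & s \end{bmatrix}$, and $f(x) = s - x - \sum_{i=1}^n \alpha_i^2/(d_i - x)$. Then for every $x \in \mathbb{R}$ with $x \ne d_i$ for all $i$, $x$ is an eigenvalue of $B$ if and only if $f(x) = 0$. -/
open Matrix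

/-- The determinant of a shifted arrowhead matrix, expanded around its diagonal block. -/
theorem det_arrowhead_sub_smul_one {n : ℕ} (d α : Fin n → ℝ) (s x : ℝ) (hx : ∀ i, x ≠ d i) :
    (Matrix.fromBlocks (Matrix.diagonal d)
        (Matrix.of fun i (_ : Fin 1) => α i) (Matrix.of fun (_ : Fin 1) j => α j)
        (Matrix.of fun (_ : Fin 1) (_ : Fin 1) => s) -
      x • (1 : Matrix (Fin n ⊕ Fin 1) (Fin n ⊕ Fin 1) ℝ)).det =
      (∏ i, (d i - x)) * (s - x - ∑ i, α i ^ 2 / (d i - x)) := by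
  have hne : ∀ i, d i - x ≠ 0 := fun i => sub_ne_zero.mpr (hx i).symm
  let inv : Invertible (diagonal fun i => d i - x) :=
    invertibleOfRightInverse _ (diagonal fun i => (d i - x)⁻¹) (by
      simp [diagonal_mul_diagonal, hne])
  have hinv : ⅟(diagonal fun i => d i - x) = diagonal fun i => (d i - x)⁻¹ := rfl
  rw [← fromBlocks_one, fromBlocks_smul, sub_eq_add_neg, fromBlocks_neg, fromBlocks_add]
  simp only [← sub_eq_add_neg, smul_zero, sub_zero]
  rw [smul_one_eq_diagonal, diagonal_sub, det_fromBlocks₁₁, hinv, det_diagonal, det_fin_one,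
    Matrix.sub_apply, mul_apply]
  simp only [mul_diagonal, Matrix.sub_apply, Matrix.smul_apply, one_apply_eq, of_apply,
    smul_eq_mul, mul_one]
  congr 2
  exact Finset.sum_congr rfl fun i _ => by ring

/-- **Secular equation of an arrowhead matrix.**  For the arrowhead matrix
`B = [diag d, α; αᵀ, s]` and any `x` distinct from all `d i`, `x` is an eigenvalue of `B`
(i.e. `det (B - x I) = 0`) if and only if the secular function
`f x = s - x - ∑ i, α i ^ 2 / (d i - x)` vanishes at `x`. -/
theorem arrowhead_eigenvalue_iff_secular {n : ℕ}
    (d α : Fin n → ℝ) (s : ℝ)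
    (B : Matrix (Fin n ⊕ Fin 1) (Fin n ⊕ Fin 1) ℝ)
    (hB : B = Matrix.fromBlocks (Matrix.diagonal d)
        (Matrix.of fun i (_ : Fin 1) => α i) (Matrix.of fun (_ : Fin 1) j => α j)
        (Matrix.of fun (_ : Fin 1) (_ : Fin 1) => s))
    (f : ℝ → ℝ) (hf : ∀ x, f x = s - x - ∑ i, α i ^ 2 / (d i - x))
    (x : ℝ) (hx : ∀ i, x ≠ d i) :
    (B - x • (1 : Matrix (Fin n ⊕ Fin 1) (Fin n ⊕ Fin 1) ℝ)).det = 0 ↔ f x = 0 := by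
  have hprod : ∏ i, (d i - x) ≠ 0 :=
    Finset.prod_ne_zero_iff.mpr fun i _ => sub_ne_zero.mpr (hx i).symm
  rw [hB, det_arrowhead_sub_smul_one d α s x hx, hf x, mul_eq_zero, or_iff_right hprod]
end

section
/- Let $d_1 > d_2 > \cdots > d_n$ be real numbers, let $\alpha \in \mathbb{R}^n$ with $\alpha_i \ne 0$ for all $i$, let $s \in \mathbb{R}$, and let $B = \begin{bmatrix} \mathrm{diag}(d_1, \ldots, d_n) & \alpha \\ \alpha^T & s \end{bmatrix} \in \mathbb{R}^{(n+1) \times (n+1)}$. Then $B$ has $n+1$ distinct real eigenvalues $\mu_1 > \mu_2 > \cdots > \mu_{n+1}$, and they strictly interlace the diagonal entries: $\mu_1 > d_1 > \mu_2 > d_2 > \cdots > \mu_n > d_n > \mu_{n+1}$; i.e., $B$ has exactly one eigenvalue in each of the $n+1$ open intervals $(d_1, \infty)$, $(d_2, d_1)$, \ldots, $(d_n, d_{n-1})$, $(-\infty, d_n)$. -/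
open Matrix

/-- The characteristic polynomial of the arrowhead matrix `[diag d, α; αᵀ, s]`, as a function
of its argument. -/
noncomputable def arrowheadCharFun {n : ℕ} (d α : Fin n → ℝ) (s x : ℝ) : ℝ :=
  (x - s) * ∏ i, (x - d i) - ∑ i, α i ^ 2 * ∏ j ∈ Finset.univ.erase i, (x - d j)

theorem continuous_arrowheadCharFun {n : ℕ} (d α : Fin n → ℝ) (s : ℝ) :
    Continuous (arrowheadCharFun d α s) := by
  unfold arrowheadCharFun
  fun_prop

/-- Away from the diagonal entries the determinant is computed by a Schur complement. -/
theorem det_sub_arrowhead_of_ne {n : ℕ} (d α : Fin n → ℝ) (s x : ℝ) (hx : ∀ i, x ≠ d i) :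
    (Matrix.scalar (Fin n ⊕ Fin 1) x - Matrix.fromBlocks (Matrix.diagonal d)
        (Matrix.of fun i (_ : Fin 1) => α i) (Matrix.of fun (_ : Fin 1) j => α j)
        (Matrix.of fun (_ : Fin 1) (_ : Fin 1) => s)).det = arrowheadCharFun d α s x := by
  have hne : ∀ i, x - d i ≠ 0 := fun i => sub_ne_zero.2 (hx i)
  have hblock : Matrix.scalar (Fin n ⊕ Fin 1) x - Matrix.fromBlocks (Matrix.diagonal d)
        (Matrix.of fun i (_ : Fin 1) => α i) (Matrix.of fun (_ : Fin 1) j => α j)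
        (Matrix.of fun (_ : Fin 1) (_ : Fin 1) => s) =
      Matrix.fromBlocks (Matrix.diagonal fun i => x - d i)
        (Matrix.of fun i (_ : Fin 1) => -α i) (Matrix.of fun (_ : Fin 1) j => -α j)
        (Matrix.of fun (_ : Fin 1) (_ : Fin 1) => x - s) := by
    ext (i | i) (j | j)
    · by_cases h : i = j <;> simp [h]
    · simp
    · simp
    · simp [Subsingleton.elim i j]
  let _ : Invertible (fun i => x - d i) :=
    ⟨fun i => (x - d i)⁻¹, by ext i; simp [hne i], by ext i; simp [hne i]⟩
  let _ : Invertible (Matrix.diagonal fun i => x - d i) := Matrix.diagonalInvertible _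
  have hinv : ⅟(Matrix.diagonal fun i => x - d i) = Matrix.diagonal fun i => (x - d i)⁻¹ := rfl
  rw [hblock, Matrix.det_fromBlocks₁₁, hinv, Matrix.det_diagonal, Matrix.det_unique,
    Matrix.sub_apply, Matrix.mul_apply]
  simp only [Matrix.mul_diagonal, Matrix.of_apply]
  rw [arrowheadCharFun, mul_sub, mul_comm, Finset.mul_sum]
  congr 1
  refine Finset.sum_congr rfl fun i _ => ?_
  rw [← Finset.mul_prod_erase _ _ (Finset.mem_univ i)]
  field_simp [hne i]

theorem eval_charpoly_arrowhead {n : ℕ} (d α : Fin n → ℝ) (s x : ℝ) :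
    (Matrix.fromBlocks (Matrix.diagonal d)
        (Matrix.of fun i (_ : Fin 1) => α i) (Matrix.of fun (_ : Fin 1) j => α j)
        (Matrix.of fun (_ : Fin 1) (_ : Fin 1) => s)).charpoly.eval x =
      arrowheadCharFun d α s x := by
  have hdense : Dense (Set.range d)ᶜ := (Set.finite_range d).countable.dense_compl ℝ
  refine congrFun (Continuous.ext_on hdense (Polynomial.continuous _)
    (continuous_arrowheadCharFun d α s) fun y hy => ?_) x
  simp only [Matrix.eval_charpoly]
  exact det_sub_arrowhead_of_ne d α s y fun i h => hy ⟨i, h.symm⟩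

theorem arrowheadCharFun_pos {n : ℕ} (d α : Fin n → ℝ) (s x : ℝ) (hd : ∀ i, d i + 1 ≤ x)
    (hs : s + ∑ i, α i ^ 2 < x) : 0 < arrowheadCharFun d α s x := by
  have hpos : 0 < ∏ i, (x - d i) := Finset.prod_pos fun i _ => by linarith [hd i]
  have hle : ∑ i, α i ^ 2 * ∏ j ∈ Finset.univ.erase i, (x - d j) ≤
      (∑ i, α i ^ 2) * ∏ i, (x - d i) := by
    rw [Finset.sum_mul]
    refine Finset.sum_le_sum fun i _ => mul_le_mul_of_nonneg_left ?_ (sq_nonneg _)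
    rw [← Finset.mul_prod_erase _ _ (Finset.mem_univ i)]
    refine le_mul_of_one_le_left (Finset.prod_nonneg fun j _ => ?_) ?_
    · linarith [hd j]
    · linarith [hd i]
  have := mul_lt_mul_of_pos_right (show ∑ i, α i ^ 2 < x - s by linarith) hpos
  unfold arrowheadCharFun
  linarith

theorem arrowheadCharFun_neg {n : ℕ} (d α : Fin n → ℝ) (s x : ℝ) :
    arrowheadCharFun d α s (-x) = (-1) ^ (n + 1) * arrowheadCharFun (-d) α (-s) x := by
  have hneg (t : Finset (Fin n)) :
      ∏ i ∈ t, (-x - d i) = (-1) ^ t.card * ∏ i ∈ t, (x - (-d) i) := by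
    rw [← Finset.prod_const, ← Finset.prod_mul_distrib]
    exact Finset.prod_congr rfl fun i _ => by simp; ring
  have herase (i : Fin n) : (-1 : ℝ) ^ (Finset.univ.erase i).card = (-1) ^ (n + 1) := by
    have h : n = (Finset.univ.erase i).card + 1 := by
      rw [Finset.card_erase_add_one (Finset.mem_univ i), Finset.card_fin]
    conv_rhs => rw [h]
    ring
  simp only [arrowheadCharFun, hneg, herase, Finset.card_fin, mul_sub, Finset.mul_sum]
  congr 1
  · ring
  · exact Finset.sum_congr rfl fun i _ => by ring

theorem arrowheadCharFun_apply_diag {n : ℕ} (d α : Fin n → ℝ) (s : ℝ) (k : Fin n) :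
    arrowheadCharFun d α s (d k) =
      -(α k ^ 2 * ∏ j ∈ Finset.univ.erase k, (d k - d j)) := by
  rw [arrowheadCharFun, Finset.prod_eq_zero (Finset.mem_univ k) (sub_self _), mul_zero, zero_sub,
    Finset.sum_eq_single k]
  · intro i _ hik
    rw [Finset.prod_eq_zero (Finset.mem_erase.2 ⟨hik.symm, Finset.mem_univ k⟩) (sub_self _),
      mul_zero]
  · simp

theorem neg_one_pow_mul_prod_sub_pos {n : ℕ} {d : Fin n → ℝ} (hd : StrictAnti d) (k : Fin n) :
    0 < (-1) ^ (k : ℕ) * ∏ j ∈ Finset.univ.erase k, (d k - d j) := by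
  have hsign : (-1 : ℝ) ^ (k : ℕ) = ∏ j ∈ Finset.univ.erase k, if j < k then -1 else 1 := by
    rw [← Finset.prod_filter, Finset.prod_const]
    congr 1
    rw [← Fin.card_Iio k]
    congr 1
    ext j
    simpa using fun h : j < k => h.ne
  rw [hsign, ← Finset.prod_mul_distrib]
  refine Finset.prod_pos fun j hj => ?_
  rcases lt_or_gt_of_ne (Finset.ne_of_mem_erase hj) with h | h
  · simpa [h] using hd h
  · simpa [h.not_gt] using hd h

/-- A continuous function whose signs alternate along a decreasing sequence has a zero strictly
between any two consecutive terms. -/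
theorem exists_zero_between_of_alternating {m : ℕ} {f : ℝ → ℝ} (hf : Continuous f)
    {e : Fin (m + 1) → ℝ} (he : StrictAnti e) (hsign : ∀ k : Fin (m + 1), 0 < (-1) ^ (k : ℕ) * f (e k))
    (k : Fin m) : ∃ x, e k.succ < x ∧ x < e k.castSucc ∧ f x = 0 := by
  have h₁ := hsign k.castSucc
  have h₂ := hsign k.succ
  have hlt := he k.castSucc_lt_succ
  rw [Fin.val_castSucc] at h₁
  rw [Fin.val_succ, pow_succ] at h₂
  obtain ⟨x, hx, hx0⟩ := intermediate_value_Ioo hlt.le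
    (f := fun x => (-1) ^ (k : ℕ) * f x) (by fun_prop)
    (show (0 : ℝ) ∈ Set.Ioo _ _ from ⟨by linarith, h₁⟩)
  exact ⟨x, hx.1, hx.2, by simpa using hx0⟩

/-- Points bracketing the eigenvalues: the diagonal entries together with one point beyond each
end of the spectrum. -/
theorem exists_arrowhead_bracket {n : ℕ} {d : Fin n → ℝ} (hd : StrictAnti d)
    {α : Fin n → ℝ} (hα : ∀ i, α i ≠ 0) (s : ℝ) :
    ∃ e : Fin (n + 2) → ℝ, StrictAnti e ∧ (∀ i : Fin n, e i.castSucc.succ = d i) ∧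
      ∀ k : Fin (n + 2), 0 < (-1) ^ (k : ℕ) * arrowheadCharFun d α s (e k) := by
  obtain ⟨M, hM, hM0, hMs⟩ : ∃ M : ℝ, (∀ i, |d i| + 1 ≤ M) ∧ 0 < M ∧
      |s| + ∑ i, α i ^ 2 < M := by
    have h₁ : 0 ≤ ∑ i, |d i| := Finset.sum_nonneg fun i _ => abs_nonneg _
    have h₂ : 0 ≤ ∑ i, α i ^ 2 := Finset.sum_nonneg fun i _ => sq_nonneg _
    have h₃ := abs_nonneg s
    refine ⟨∑ i, |d i| + |s| + ∑ i, α i ^ 2 + 1, fun i => ?_, by linarith, by linarith⟩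
    have := Finset.single_le_sum (fun i _ => abs_nonneg (d i)) (Finset.mem_univ i)
    linarith
  refine ⟨Fin.cons M (Fin.snoc d (-M)), ?_, fun i => by simp, ?_⟩
  · refine Fin.strictAnti_iff_succ_lt.2 fun i => ?_
    rw [Fin.cons_succ]
    induction i using Fin.cases with
    | zero =>
      rw [Fin.castSucc_zero, Fin.cons_zero]
      cases n with
      | zero => simpa [Fin.snoc] using (by linarith : -M < M)
      | succ n =>
        rw [← Fin.castSucc_zero, Fin.snoc_castSucc]
        linarith [hM 0, le_abs_self (d 0)]
    | succ i =>
      rw [← Fin.succ_castSucc, Fin.cons_succ, Fin.snoc_castSucc]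
      rcases Nat.lt_or_ge (i + 1) n with h | h
      · have : i.succ = Fin.castSucc ⟨i + 1, h⟩ := rfl
        rw [this, Fin.snoc_castSucc]
        exact hd (Nat.lt_succ_self _)
      · have : i.succ = Fin.last n := Fin.ext (by simp; omega)
        rw [this, Fin.snoc_last]
        linarith [hM i, neg_abs_le (d i)]
  · intro k
    induction k using Fin.cases with
    | zero =>
      simpa using arrowheadCharFun_pos d α s M
        (fun i => by linarith [hM i, le_abs_self (d i)]) (by linarith [le_abs_self s])
    | succ k =>
      rw [Fin.cons_succ, Fin.val_succ]
      induction k using Fin.lastCases with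
      | last =>
        rw [Fin.snoc_last, arrowheadCharFun_neg, Fin.val_last, ← mul_assoc, ← mul_pow]
        simpa using arrowheadCharFun_pos (-d) α (-s) M
          (fun i => by
            rw [Pi.neg_apply]
            linarith [hM i, neg_abs_le (d i)]) (by linarith [neg_abs_le s])
      | cast k =>
        rw [Fin.snoc_castSucc, arrowheadCharFun_apply_diag, Fin.val_castSucc]
        have := mul_pos (pow_pos (abs_pos.2 (hα k)) 2) (neg_one_pow_mul_prod_sub_pos hd k)
        rw [sq_abs] at this
        rw [pow_succ]
        linarith

/-- If a polynomial of degree at most `m` has `m` distinct roots, it has no others. -/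
theorem eval_eq_zero_iff_of_injective {R : Type*} [CommRing R] [IsDomain R] {m : ℕ}
    {p : Polynomial R} (hp : p ≠ 0) (hdeg : p.natDegree ≤ m) {μ : Fin m → R}
    (hμ : Function.Injective μ) (hroot : ∀ k, p.eval (μ k) = 0) (x : R) :
    p.eval x = 0 ↔ ∃ k, μ k = x := by
  classical
  refine ⟨fun hx => ?_, fun ⟨k, hk⟩ => hk ▸ hroot k⟩
  have hsub : Finset.univ.image μ ⊆ p.roots.toFinset := by
    intro y hy
    obtain ⟨k, -, rfl⟩ := Finset.mem_image.1 hy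
    simpa [hp] using hroot k
  have heq := Finset.eq_of_subset_of_card_le hsub <| by
    rw [Finset.card_image_of_injective _ hμ, Finset.card_fin]
    exact (Multiset.toFinset_card_le _).trans (p.card_roots'.trans hdeg)
  have hmem : x ∈ Finset.univ.image μ := by
    rw [heq]
    simpa [hp] using hx
  simpa using hmem

/-- **Strict interlacing of arrowhead eigenvalues.**  If `d 0 > d 1 > ⋯ > d (n-1)` and all
`α i ≠ 0`, then the arrowhead matrix `B = [diag d, α; αᵀ, s]` has `n + 1` distinct real
eigenvalues `μ 0 > μ 1 > ⋯ > μ n` (the real roots of `det (B - x I) = 0`), and they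
strictly interlace the diagonal entries: `μ i > d i > μ (i+1)` for each `i`; i.e. `B` has
exactly one eigenvalue in each of the `n + 1` open intervals determined by the `d i`. -/
theorem arrowhead_eigenvalues_strictly_interlace {n : ℕ}
    (d : Fin n → ℝ) (hd : StrictAnti d)
    (α : Fin n → ℝ) (hα : ∀ i, α i ≠ 0) (s : ℝ)
    (B : Matrix (Fin n ⊕ Fin 1) (Fin n ⊕ Fin 1) ℝ)
    (hB : B = Matrix.fromBlocks (Matrix.diagonal d)
        (Matrix.of fun i (_ : Fin 1) => α i) (Matrix.of fun (_ : Fin 1) j => α j)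
        (Matrix.of fun (_ : Fin 1) (_ : Fin 1) => s)) :
    ∃ μ : Fin (n + 1) → ℝ, StrictAnti μ ∧
      (∀ x : ℝ,
        (B - x • (1 : Matrix (Fin n ⊕ Fin 1) (Fin n ⊕ Fin 1) ℝ)).det = 0 ↔ ∃ k, μ k = x) ∧
      ∀ i : Fin n, d i < μ i.castSucc ∧ μ i.succ < d i := by
  obtain ⟨e, he, hed, hsign⟩ := exists_arrowhead_bracket hd hα s
  choose μ hlo hhi hzero using
    exists_zero_between_of_alternating (continuous_arrowheadCharFun d α s) he hsign
  have hanti : StrictAnti μ := Fin.strictAnti_iff_succ_lt.2 fun i =>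
    ((hhi i.succ).trans_eq (by rw [Fin.succ_castSucc])).trans (hlo i.castSucc)
  refine ⟨μ, hanti, fun x => ?_, fun i => ⟨?_, ?_⟩⟩
  · have hdet : (B - x • (1 : Matrix (Fin n ⊕ Fin 1) (Fin n ⊕ Fin 1) ℝ)).det = 0 ↔
        B.charpoly.eval x = 0 := by
      rw [Matrix.eval_charpoly, ← neg_sub, Matrix.det_neg, Matrix.smul_one_eq_diagonal,
        Matrix.scalar_apply]
      simp
    rw [hdet]
    refine eval_eq_zero_iff_of_injective B.charpoly_monic.ne_zero ?_ hanti.injective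
      (fun k => ?_) x
    · simp [Matrix.charpoly_natDegree_eq_dim]
    · rw [hB, eval_charpoly_arrowhead, hzero]
  · exact hed i ▸ hlo i.castSucc
  · rw [← hed i, Fin.succ_castSucc]
    exact hhi i.succ
end
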